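/- If a finite undirected graph G is a minor of a finite undirected graph H, then Ent(G) ≤ Ent(H). In particular, for every fixed k ∈ ℕ, the class of finite undirected graphs of entanglement at most k is closed under taking minors. -/

import Mathlib

/-!
The entanglement game `Ent(G,k)` on a graph with adjacency relation
`E : V → V → Prop` is played by Robber against `k` cops.  Positions are
`(v, C, P)` with `v : V`, `C : Finset V` with `C.card ≤ k`, and
`P ∈ {Cops, Robber}`.  Initially Robber chooses `v₀` and moves to
`(v₀, ∅, Cops)`.  From `(v, C, Cops)`, Cops may skip, add a cop on `v`
(if at most `k` cops are then placed), or move a placed cop to `v`; from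
`(v, C, Robber)`, Robber moves along an edge to a vertex free of cops.
Every finite play is a win for Cops, so "Cops have a winning strategy from
`(v, C, Cops)`" is the inductive predicate `EntCopsWinFrom`.  The
entanglement of the graph is the least `k` such that Cops have a winning
strategy in `Ent(G,k)` (it is at most the number of vertices).
-/

variable {V : Type*} [DecidableEq V]

/-- A legal Cops move in the game `Ent(G,k)`: from position `(v, C, Cops)`
Cops may go to `(v, C', Robber)` where `C'` is `C` (skip), `C ∪ {v}` provided
at most `k` cops are used (add), or `(C \ {x}) ∪ {v}` for some `x ∈ C`
(move a placed cop). -/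
def EntCopsMove (k : ℕ) (v : V) (C C' : Finset V) : Prop :=
  C' = C ∨ (C' = insert v C ∧ (insert v C).card ≤ k) ∨
    ∃ x ∈ C, C' = insert v (C.erase x)

/-- Cops have a winning strategy in `Ent(G,k)` from position `(v, C, Cops)`. -/
inductive EntCopsWinFrom (E : V → V → Prop) (k : ℕ) : V → Finset V → Prop
  | step (v : V) (C C' : Finset V) (hmove : EntCopsMove k v C C')
      (h : ∀ v', E v v' → v' ∉ C' → EntCopsWinFrom E k v' C') :
      EntCopsWinFrom E k v C

/-- Cops have a winning strategy in the game `Ent(G,k)`. -/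
def EntCopsWin (E : V → V → Prop) (k : ℕ) : Prop :=
  ∀ v : V, EntCopsWinFrom E k v ∅

/-- The entanglement of a graph: the least number `k` of cops such that Cops
have a winning strategy in the game `Ent(G,k)`. -/
noncomputable def entanglement (E : V → V → Prop) : ℕ :=
  sInf {k | EntCopsWin E k}

universe u

/-- A finite undirected graph, bundled with its (finite, decidable) vertex
type. -/
structure FinGraph : Type (u + 1) where
  V : Type u
  [instFintype : Fintype V]
  [instDecEq : DecidableEq V]
  G : SimpleGraph V

attribute [instance] FinGraph.instFintype FinGraph.instDecEq

/-- The entanglement of a bundled finite graph. -/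
noncomputable def FinGraph.ent (X : FinGraph) : ℕ :=
  entanglement X.G.Adj

/-- `X` is obtained from `Y` by deleting one edge. -/
def FinGraph.IsEdgeDeletion (X Y : FinGraph) : Prop :=
  ∃ a b : Y.V, Y.G.Adj a b ∧ Nonempty (X.G ≃g Y.G.deleteEdges {s(a, b)})

/-- `X` is obtained from `Y` by contracting one edge `ab` to a new vertex `z`
which inherits all the neighbours of `a` and `b`; the contraction is
witnessed by the surjection `f` identifying exactly `a` and `b`. -/
def FinGraph.IsEdgeContraction (X Y : FinGraph) : Prop :=
  ∃ (a b : Y.V) (z : X.V) (f : Y.V → X.V),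
    Y.G.Adj a b ∧ f a = z ∧ f b = z ∧ Function.Surjective f ∧
    (∀ u v : Y.V, u ≠ v → f u = f v → (u = a ∧ v = b) ∨ (u = b ∧ v = a)) ∧
    (∀ x y : X.V,
      X.G.Adj x y ↔ x ≠ y ∧ ∃ u v : Y.V, f u = x ∧ f v = y ∧ Y.G.Adj u v)

/-- `X` is obtained from `Y` by deleting one isolated vertex. -/
def FinGraph.IsIsolatedVertexDeletion (X Y : FinGraph) : Prop :=
  ∃ v : Y.V, (∀ w, ¬ Y.G.Adj v w) ∧
    Nonempty (X.G ≃g Y.G.induce ({v}ᶜ : Set Y.V))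

/-- `X` is a direct minor of `Y`: it is obtained from `Y` by a single
operation of edge deletion, edge contraction, or deletion of an isolated
vertex. -/
def FinGraph.DirectMinor (X Y : FinGraph) : Prop :=
  X.IsEdgeDeletion Y ∨ X.IsEdgeContraction Y ∨ X.IsIsolatedVertexDeletion Y

/-- `X` is a minor of `Y`: it is obtained from `Y` by successive edge
deletions, edge contractions and deletions of isolated vertices. -/
def FinGraph.IsMinor (X Y : FinGraph) : Prop :=
  Relation.ReflTransGen FinGraph.DirectMinor X Y

/-- `X` is a proper minor of `Y`: a minor obtained by at least one
operation. -/
def FinGraph.ProperMinor (X Y : FinGraph) : Prop :=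
  Relation.TransGen FinGraph.DirectMinor X Y

section EntanglementMinor

variable {α β : Type*} [DecidableEq α] [DecidableEq β] {k : ℕ}

theorem EntCopsMove.subset_insert {v : α} {C C' : Finset α} (h : EntCopsMove k v C C') :
    C' ⊆ insert v C := by
  rcases h with rfl | ⟨rfl, -⟩ | ⟨x, -, rfl⟩
  · exact Finset.subset_insert _ _
  · exact subset_rfl
  · exact Finset.insert_subset_insert _ (Finset.erase_subset _ _)

theorem EntCopsMove.card_le {v : α} {C C' : Finset α} (h : EntCopsMove k v C C')
    (hC : C.card ≤ k) : C'.card ≤ k := by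
  rcases h with rfl | ⟨rfl, h⟩ | ⟨x, hx, rfl⟩
  · exact hC
  · exact h
  · have := Finset.card_insert_le v (C.erase x)
    have := Finset.card_erase_add_one hx
    omega

/-- A legal Cops move can cover any set of at most `k` vertices among the current vertex and the
vertices already guarded. -/
theorem exists_entCopsMove_superset {v : α} {C D : Finset α} (hC : C.card ≤ k)
    (hCD : C ⊆ insert v D) : ∃ D', EntCopsMove k v D D' ∧ C ⊆ D' := by
  by_cases hv : v ∈ C
  · by_cases hk : (insert v D).card ≤ k
    · exact ⟨_, Or.inr (Or.inl ⟨rfl, hk⟩), hCD⟩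
    · obtain ⟨x, hx, hxC⟩ : ∃ x ∈ insert v D, x ∉ C := by
        by_contra! h
        exact hk ((Finset.card_le_card h).trans hC)
      have hxv : x ≠ v := fun h => hxC (h ▸ hv)
      refine ⟨_, Or.inr (Or.inr ⟨x, (Finset.mem_insert.1 hx).resolve_left hxv, rfl⟩), ?_⟩
      intro y hy
      have hyx : y ≠ x := fun h => hxC (h ▸ hy)
      have := hCD hy
      simp_all
  · exact ⟨D, Or.inl rfl, (Finset.subset_insert_iff_of_notMem hv).1 hCD⟩

theorem entCopsWin_card [Fintype α] (E : α → α → Prop) : EntCopsWin E (Fintype.card α) := by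
  suffices h : ∀ (n : ℕ) (C : Finset α) (v : α), v ∉ C → Cᶜ.card = n →
      EntCopsWinFrom E (Fintype.card α) v C from
    fun v => h _ ∅ v (Finset.notMem_empty v) rfl
  intro n
  induction n using Nat.strong_induction_on with
  | _ n ih =>
    intro C v hv hn
    refine .step v C (insert v C) (Or.inr (Or.inl ⟨rfl, Finset.card_le_univ _⟩)) ?_
    intro w _ hw
    refine ih _ ?_ _ w hw rfl
    rw [← hn]
    exact Finset.card_lt_card (compl_lt_compl_iff_lt.2 (Finset.ssubset_insert hv))

theorem entanglement_le_of_imp [Fintype β] {E : α → α → Prop} {F : β → β → Prop}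
    (h : ∀ k, EntCopsWin F k → EntCopsWin E k) : entanglement E ≤ entanglement F :=
  Nat.sInf_le (h _ (Nat.sInf_mem (s := {k | EntCopsWin F k}) ⟨_, entCopsWin_card F⟩))

/-- Cops winning positions pull back along injective homomorphisms. -/
theorem EntCopsWinFrom.comap {E : α → α → Prop} {F : β → β → Prop} {f : α → β}
    (hf : Function.Injective f) (hEF : ∀ x y, E x y → F (f x) (f y))
    {v : β} {C : Finset β} (h : EntCopsWinFrom F k v C) (hC : C.card ≤ k)
    {x : α} {D : Finset α} (hx : f x = v) (hCD : ∀ y, f y ∈ C → y ∈ D) :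
    EntCopsWinFrom E k x D := by
  induction h generalizing x D with
  | step v C C' hmove _ ih =>
    subst hx
    have hC' := hmove.card_le hC
    obtain ⟨D', hDmove, hD'⟩ := exists_entCopsMove_superset (v := x)
      (C := C'.preimage f hf.injOn)
      ((Finset.card_le_card_of_injOn f (by simp [Set.MapsTo]) hf.injOn).trans hC') (by
        intro y hy
        have := hmove.subset_insert (Finset.mem_preimage.1 hy)
        rw [Finset.mem_insert] at this ⊢
        exact this.imp (fun h => hf h) (hCD y))
    have hcov : ∀ y, f y ∈ C' → y ∈ D' := fun y hy => hD' (Finset.mem_preimage.2 hy)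
    exact .step x D D' hDmove fun y hxy hy =>
      ih (f y) (hEF x y hxy) (fun h => hy (hcov y h)) hC' rfl hcov

theorem EntCopsWin.comap {E : α → α → Prop} {F : β → β → Prop} {f : α → β}
    (hf : Function.Injective f) (hEF : ∀ x y, E x y → F (f x) (f y)) (h : EntCopsWin F k) :
    EntCopsWin E k :=
  fun x => (h (f x)).comap hf hEF (by simp) rfl (by simp)

/-- Cops winning positions push forward along quotient maps whose fibres are cliques. The second
component serves when Robber leaves a fibre that is already guarded, so that Cops need
not react to the vertex through which Robber leaves. -/
theorem EntCopsWinFrom.map {E : α → α → Prop} {F : β → β → Prop} {f : β → α}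
    (hfib : ∀ u w, u ≠ w → f u = f w → F u w)
    (hlift : ∀ x y, E x y → ∃ u v, f u = x ∧ f v = y ∧ F u v)
    {u : β} {C : Finset β} (h : EntCopsWinFrom F k u C) (hC : C.card ≤ k)
    {D : Finset α} (hCD : ∀ w ∈ C, f w ∈ D) :
    (f u ∉ D → EntCopsWinFrom E k (f u) D) ∧
      (f u ∈ D → ∀ v, F u v → f v ∉ D → EntCopsWinFrom E k (f v) D) := by
  induction h generalizing D with
  | step u C C' hmove _ ih =>
    have hC' := hmove.card_le hC
    refine ⟨fun hu => ?_, fun hu v huv hv => ?_⟩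
    · by_cases huC' : u ∈ C'
      · obtain ⟨D', hDmove, hD'⟩ := exists_entCopsMove_superset (v := f u) (C := C'.image f)
          (Finset.card_image_le.trans hC') (by
            intro y hy
            obtain ⟨w, hw, rfl⟩ := Finset.mem_image.1 hy
            rcases Finset.mem_insert.1 (hmove.subset_insert hw) with rfl | hw
            · exact Finset.mem_insert_self _ _
            · exact Finset.mem_insert_of_mem (hCD w hw))
        have hcov : ∀ w ∈ C', f w ∈ D' := fun w hw => hD' (Finset.mem_image_of_mem f hw)
        refine .step _ D D' hDmove fun y hxy hy => ?_
        obtain ⟨w, v, hwu, rfl, hwv⟩ := hlift _ _ hxy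
        by_cases hne : u = w
        · subst hne
          exact (ih v hwv (fun h => hy (hcov v h)) hC' hcov).1 hy
        · have hwC' : w ∉ C' := fun h => by
            rcases Finset.mem_insert.1 (hmove.subset_insert h) with rfl | h
            · exact hne rfl
            · exact hu (hwu ▸ hCD w h)
          exact (ih w (hfib u w hne hwu.symm) hwC' hC' hcov).2
            (hwu ▸ hcov u huC') v hwv hy
      · have hcov : ∀ w ∈ C', f w ∈ D := fun w hw =>
          hCD w ((Finset.subset_insert_iff_of_notMem huC').1 hmove.subset_insert hw)
        by_cases hw : ∃ w, u ≠ w ∧ f u = f w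
        · obtain ⟨w, hne, hwu⟩ := hw
          rw [hwu] at hu ⊢
          exact (ih w (hfib u w hne hwu) (fun h => hu (hcov w h)) hC' hcov).1 hu
        · refine .step _ D D (Or.inl rfl) fun y hxy hy => ?_
          obtain ⟨w, v, hwu, rfl, hwv⟩ := hlift _ _ hxy
          obtain rfl : u = w := by
            by_contra hne
            exact hw ⟨w, hne, hwu.symm⟩
          exact (ih v hwv (fun h => hy (hcov v h)) hC' hcov).1 hy
    · have hcov : ∀ w ∈ C', f w ∈ D := fun w hw => by
        rcases Finset.mem_insert.1 (hmove.subset_insert hw) with rfl | hw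
        · exact hu
        · exact hCD w hw
      exact (ih v huv (fun h => hv (hcov v h)) hC' hcov).1 hv

theorem EntCopsWin.map {E : α → α → Prop} {F : β → β → Prop} {f : β → α}
    (hf : Function.Surjective f) (hfib : ∀ u w, u ≠ w → f u = f w → F u w)
    (hlift : ∀ x y, E x y → ∃ u v, f u = x ∧ f v = y ∧ F u v) (h : EntCopsWin F k) :
    EntCopsWin E k := by
  intro x
  obtain ⟨u, rfl⟩ := hf x
  exact ((h u).map hfib hlift (by simp) (by simp)).1 (by simp)

end EntanglementMinor

theorem FinGraph.DirectMinor.ent_le {X Y : FinGraph} (h : X.DirectMinor Y) : X.ent ≤ Y.ent := by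
  refine entanglement_le_of_imp fun k hk => ?_
  rcases h with ⟨a, b, -, ⟨e⟩⟩ | ⟨a, b, z, f, hab, -, -, hsurj, hfib, hadj⟩ | ⟨v, -, ⟨e⟩⟩
  · exact hk.comap e.injective fun x y hxy =>
      Y.G.deleteEdges_le _ (e.map_adj_iff.2 hxy)
  · refine hk.map hsurj (fun u w hne huw => ?_) fun x y hxy => ((hadj x y).1 hxy).2
    rcases hfib u w hne huw with ⟨rfl, rfl⟩ | ⟨rfl, rfl⟩
    · exact hab
    · exact hab.symm
  · exact hk.comap (Subtype.val_injective.comp e.injective) fun x y hxy => e.map_adj_iff.2 hxy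

/-- If a finite undirected graph `G` is a minor of a finite undirected graph
`H`, then `Ent(G) ≤ Ent(H)`; in particular, for every fixed `k`, the class of
finite undirected graphs of entanglement at most `k` is closed under taking
minors. -/
theorem ent_minor_le (G H : FinGraph) (h : G.IsMinor H) :
    G.ent ≤ H.ent ∧ ∀ k : ℕ, H.ent ≤ k → G.ent ≤ k := by
  have hle : G.ent ≤ H.ent := by
    induction h with
    | refl => exact le_rfl
    | tail _ hstep ih => exact ih.trans hstep.ent_le
  exact ⟨hle, fun _ hk => hle.trans hk⟩
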